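/- Let X be a real-valued random variable and f : ℝ → ℝ a Borel-measurable function such that f(X) is discrete with finite, strictly positive Shannon entropy. Then the hypercontractivity coefficients satisfy s(X; f(X)) = 1 and s(f(X); X) = 1. -/

import Mathlib

open MeasureTheory ProbabilityTheory Real

/-- Kullback–Leibler divergence between two measures, valued in the extended reals. -/
noncomputable def klDivE {α : Type*} [MeasurableSpace α] (μ ν : Measure α) : EReal :=
  open Classical in
  if μ ≪ ν ∧ Integrable (llr μ ν) μ then ((∫ x, llr μ ν x ∂μ : ℝ) : EReal) else ⊤

/-- Mutual information `I(U;X) = D(law(U,X) ‖ law U ⊗ law X)`. -/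
noncomputable def mutInfoE {Ω α β : Type*} [MeasurableSpace Ω] [MeasurableSpace α]
    [MeasurableSpace β] (U : Ω → α) (X : Ω → β) (P : Measure Ω) : EReal :=
  klDivE (P.map (fun ω => (U ω, X ω))) ((P.map U).prod (P.map X))

/-- A witness for the supremum defining the hypercontractivity coefficient of a joint law `μ`
on `ℝ × ℝ`: a random variable `U` with values in an arbitrary measurable space, defined on a
(possibly enlarged) probability space carrying random variables `X`, `Y` whose joint law is `μ`,
such that `U — X — Y` is a Markov chain (i.e. `U` and `Y` are conditionally independent
given `X`). -/
structure MarkovWitness (μ : Measure (ℝ × ℝ)) where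
  (Ω : Type)
  [mΩ : MeasurableSpace Ω]
  [sb : StandardBorelSpace Ω]
  (P : Measure Ω)
  [probP : IsProbabilityMeasure P]
  (A : Type)
  [mA : MeasurableSpace A]
  (U : Ω → A)
  (X : Ω → ℝ)
  (Y : Ω → ℝ)
  (measU : Measurable U)
  (measX : Measurable X)
  (measY : Measurable Y)
  (law_eq : P.map (fun ω => (X ω, Y ω)) = μ)
  (markov : CondIndepFun (MeasurableSpace.comap X inferInstance) measX.comap_le U Y P)

attribute [instance] MarkovWitness.mΩ MarkovWitness.sb MarkovWitness.probP MarkovWitness.mA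

/-- The hypercontractivity coefficient `s(X;Y) = sup I(U;Y)/I(U;X)`, the supremum over all `U`
(on a possibly enlarged probability space) such that `U — X — Y` is a Markov chain and
`0 < I(U;X) < ∞`. -/
noncomputable def hc {Ω : Type*} [MeasurableSpace Ω] (P : Measure Ω) (X Y : Ω → ℝ) : ℝ :=
  sSup { t | ∃ w : MarkovWitness (P.map (fun ω => (X ω, Y ω))),
    0 < mutInfoE w.U w.X w.P ∧ mutInfoE w.U w.X w.P < ⊤ ∧
    t = (mutInfoE w.U w.Y w.P).toReal / (mutInfoE w.U w.X w.P).toReal }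

open InformationTheory in
lemma klDivE_eq_klDiv {α : Type*} [MeasurableSpace α] (μ ν : Measure α)
    [IsProbabilityMeasure μ] [IsProbabilityMeasure ν] :
    klDivE μ ν = ((klDiv μ ν : ENNReal) : EReal) := by
  unfold klDivE
  split_ifs with h
  · rw [← toReal_klDiv_of_measure_eq h.1 (by simp)]
    exact EReal.coe_ennreal_toReal (klDiv_ne_top h.1 h.2)
  · have : klDiv μ ν = ⊤ := by
      rw [klDiv_eq_top_iff]; tauto
    simp [this]

lemma joint_eq_comp {Ω A : Type*} [MeasurableSpace Ω] [StandardBorelSpace Ω] [MeasurableSpace A]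
    (P : Measure Ω) [IsProbabilityMeasure P] (U : Ω → A) (X Y : Ω → ℝ)
    (hU : Measurable U) (hX : Measurable X) (hY : Measurable Y)
    (h : CondIndepFun (MeasurableSpace.comap X inferInstance) hX.comap_le U Y P) :
    P.map (fun ω => (U ω, Y ω)) =
      (Kernel.id ∥ₖ condDistrib Y X P) ∘ₘ (P.map (fun ω => (U ω, X ω))) := by
  have hm := hX.comap_le
  have := Measure.isProbabilityMeasure_map (μ := P) (f := fun ω => (U ω, Y ω)) (by fun_prop)
  refine Measure.ext_prod fun {s t} hs ht => ?_
  rw [Measure.bind_apply (hs.prod ht) (by fun_prop),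
    lintegral_map (Kernel.measurable_coe _ (hs.prod ht)) (by fun_prop),
    Measure.map_apply (by fun_prop) (hs.prod ht)]
  simp only [Kernel.parallelComp_apply_prod, Kernel.id_apply, Measure.dirac_apply' _ hs]
  rw [condIndepFun_iff_condExp_inter_preimage_eq_mul hU hY] at h
  have h1 := h s t hs ht
  have h2 := condDistrib_ae_eq_condExp (μ := P) hX hY ht
  set g := P⟦Y ⁻¹' t | MeasurableSpace.comap X inferInstance⟧ with hg
  have hint : Integrable ((U ⁻¹' s).indicator (fun _ => (1:ℝ))) P :=
    (integrable_const _).indicator (hU hs)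
  have hgi : Integrable ((U ⁻¹' s).indicator (fun _ => (1:ℝ)) * g) P := by
    have e : (U ⁻¹' s).indicator (fun _ => (1:ℝ)) * g = (U ⁻¹' s).indicator g := by
      ext ω; by_cases hω : ω ∈ U ⁻¹' s <;> simp [hω]
    rw [e]
    exact integrable_condExp.indicator (hU hs)
  have h3 := condExp_mul_of_stronglyMeasurable_right (μ := P)
    (m := MeasurableSpace.comap X inferInstance) (stronglyMeasurable_condExp) hgi hint
  have h4 : P.real (U ⁻¹' s ∩ Y ⁻¹' t) =
      ∫ ω, (U ⁻¹' s).indicator (fun _ => (1:ℝ)) ω * (condDistrib Y X P (X ω)).real t ∂P := by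
    calc P.real (U ⁻¹' s ∩ Y ⁻¹' t)
      _ = ∫ ω, (U ⁻¹' s ∩ Y ⁻¹' t).indicator (fun _ => (1:ℝ)) ω ∂P := by
        rw [integral_indicator ((hU hs).inter (hY ht))]; simp
      _ = ∫ ω, (P⟦U ⁻¹' s ∩ Y ⁻¹' t | MeasurableSpace.comap X inferInstance⟧) ω ∂P :=
        (integral_condExp hm).symm
      _ = ∫ ω, ((U ⁻¹' s).indicator (fun _ => (1:ℝ)) * g) ω ∂P := by
        rw [← integral_condExp hm (f := (U ⁻¹' s).indicator (fun _ => (1:ℝ)) * g)]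
        exact integral_congr_ae (h1.trans h3.symm)
      _ = _ := by
        refine integral_congr_ae ?_
        filter_upwards [h2] with ω hω
        simp [← hω]
  have h5 : ∀ ω, (s.indicator 1 (U ω) : ENNReal) * (condDistrib Y X P (X ω)) t =
      ENNReal.ofReal ((U ⁻¹' s).indicator (fun _ => (1:ℝ)) ω * (condDistrib Y X P (X ω)).real t) := by
    intro ω
    by_cases hω : U ω ∈ s <;> simp [hω]
  simp_rw [h5]
  rw [← ofReal_integral_eq_lintegral_ofReal, ← h4]
  · simp [Set.mk_preimage_prod]
  · refine hgi.congr ?_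
    filter_upwards [h2] with ω hω
    simp [← hω]
  · refine Filter.Eventually.of_forall fun ω => ?_
    exact mul_nonneg (Set.indicator_nonneg (by simp) _) measureReal_nonneg

open InformationTheory in
lemma mutInfoE_dpi {Ω A : Type*} [MeasurableSpace Ω] [StandardBorelSpace Ω] [MeasurableSpace A]
    (P : Measure Ω) [IsProbabilityMeasure P] (U : Ω → A) (X Y : Ω → ℝ)
    (hU : Measurable U) (hX : Measurable X) (hY : Measurable Y)
    (h : CondIndepFun (MeasurableSpace.comap X inferInstance) hX.comap_le U Y P) :
    mutInfoE U Y P ≤ mutInfoE U X P := by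
  have i1 := Measure.isProbabilityMeasure_map (μ := P) (f := fun ω => (U ω, Y ω)) (by fun_prop)
  have i2 := Measure.isProbabilityMeasure_map (μ := P) (f := fun ω => (U ω, X ω)) (by fun_prop)
  have i3 := Measure.isProbabilityMeasure_map (μ := P) hU.aemeasurable
  have i4 := Measure.isProbabilityMeasure_map (μ := P) hX.aemeasurable
  have i5 := Measure.isProbabilityMeasure_map (μ := P) hY.aemeasurable
  unfold mutInfoE
  rw [klDivE_eq_klDiv, klDivE_eq_klDiv, EReal.coe_ennreal_le_coe_ennreal_iff,
    joint_eq_comp P U X Y hU hX hY h]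
  have e : (P.map U).prod (P.map Y) =
      (Kernel.id ∥ₖ condDistrib Y X P) ∘ₘ ((P.map U).prod (P.map X)) := by
    refine Measure.ext_prod fun {s t} hs ht => ?_
    rw [Measure.bind_apply (hs.prod ht) (by fun_prop), Measure.prod_prod]
    simp only [Kernel.parallelComp_apply_prod, Kernel.id_apply, Measure.dirac_apply' _ hs]
    conv_lhs => rw [← condDistrib_comp_map hX.aemeasurable hY.aemeasurable (μ := P)]
    rw [Measure.bind_apply ht (by fun_prop), lintegral_prod_mul (f := s.indicator 1)
      (g := fun x => condDistrib Y X P x t) (by measurability)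
      (Kernel.measurable_coe _ ht).aemeasurable, lintegral_indicator_one hs]
  rw [e]
  exact klDiv_comp_right_le _ _ _

open InformationTheory in
lemma kl_diag (q : Measure ℝ) [IsProbabilityMeasure q] (S : Set ℝ) (hS : S.Countable)
    (hfull : q S = 1)
    (hsummable : Summable (fun y : S => (q {(y:ℝ)}).toReal * Real.log (q {(y : ℝ)}).toReal))
    (hpos : 0 < -∑' y : S, (q {(y:ℝ)}).toReal * Real.log (q {(y : ℝ)}).toReal) :
    klDiv (q.map (fun y => (y, y))) (q.prod q) ≠ 0 ∧
    klDiv (q.map (fun y => (y, y))) (q.prod q) ≠ ⊤ := by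
  have hd : Measurable (fun y : ℝ => (y, y)) := by fun_prop
  have i1 := Measure.isProbabilityMeasure_map (μ := q) hd.aemeasurable
  have hSm : MeasurableSet S := hS.measurableSet
  have hSae : ∀ᵐ y ∂q, y ∈ S := by
    rw [← prob_compl_eq_zero_iff hSm] at hfull
    exact hfull
  constructor
  · intro h0
    rw [klDiv_eq_zero_iff] at h0
    have hz : ∀ y : ℝ, (q {y}).toReal * Real.log (q {y}).toReal = 0 := by
      intro y
      have := congrArg (fun m => (m ({y} ×ˢ {y})).toReal) h0
      simp only [Measure.prod_prod, ENNReal.toReal_mul] at this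
      rw [Measure.map_apply hd ((measurableSet_singleton _).prod (measurableSet_singleton _))] at this
      have e : (fun y : ℝ => (y, y)) ⁻¹' ({y} ×ˢ {y}) = {y} := by ext; simp
      rw [e] at this
      have h2 : (q {y}).toReal * ((q {y}).toReal - 1) = 0 := by linarith
      rcases mul_eq_zero.1 h2 with h | h
      · simp [h]
      · simp [show (q {y}).toReal = 1 by linarith]
    simp [hz] at hpos
  · have hqm : Measurable (fun a : ℝ => q {a}) := by
      have := measurable_measure_prodMk_left (ν := q) (measurableSet_diagonal (α := ℝ))
      convert this using 3 with a
      ext b; simp [eq_comm]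
    have hq0 : ∀ᵐ y ∂q, q {y} ≠ 0 := by
      have : ∀ᵐ y ∂q, ∀ z ∈ S, q {z} = 0 → y ≠ z := by
        rw [ae_ball_iff hS]
        intro z hz
        by_cases h : q {z} = 0
        · have : ∀ᵐ y ∂q, y ≠ z := by
            rw [ae_iff]; simpa using h
          filter_upwards [this] with y hy _ using hy
        · simp [h]
      filter_upwards [this, hSae] with y hy hyS h
      exact hy y hyS h rfl
    let g : ℝ × ℝ → ENNReal := (Set.diagonal ℝ).indicator (fun p => (q {p.1})⁻¹)
    have hg : Measurable g :=
      (Measurable.inv (hqm.comp measurable_fst)).indicator measurableSet_diagonal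
    have hw : q.map (fun y => (y, y)) = (q.prod q).withDensity g := by
      ext s hs
      rw [Measure.map_apply hd hs, withDensity_apply _ hs, ← lintegral_indicator hs,
        lintegral_prod _ (hg.indicator hs).aemeasurable, ← lintegral_indicator_one (hd hs)]
      refine lintegral_congr_ae ?_
      filter_upwards [hq0] with a ha
      have e : (fun b => s.indicator g (a, b)) =
          ({a} : Set ℝ).indicator (fun _ => s.indicator (fun _ => (q {a})⁻¹) (a, a)) := by
        ext b
        by_cases hb : b = a
        · subst hb
          by_cases hbs : (b, b) ∈ s <;> simp [g, hbs]
        · have : a ≠ b := fun h => hb h.symm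
          by_cases hbs : (a, b) ∈ s <;> simp [g, hbs, hb, this]
      rw [e, lintegral_indicator_const (measurableSet_singleton a)]
      by_cases hbs : (a, a) ∈ s
      · simp [hbs, ENNReal.inv_mul_cancel ha (measure_ne_top q _)]
      · simp [hbs]
    have hac : q.map (fun y => (y, y)) ≪ q.prod q := by
      rw [hw]; exact withDensity_absolutelyContinuous _ _
    refine klDiv_ne_top hac ?_
    have hr : (q.map (fun y => (y, y))).rnDeriv (q.prod q) =ᵐ[q.map (fun y => (y, y))] g := by
      have h := Measure.rnDeriv_withDensity (q.prod q) hg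
      rw [← hw] at h
      exact hac.ae_le h
    have hl : llr (q.map (fun y => (y, y))) (q.prod q) =ᵐ[q.map (fun y => (y, y))]
        fun p => Real.log (g p).toReal := by
      filter_upwards [hr] with p hp
      simp [llr, hp]
    rw [integrable_congr hl, integrable_map_measure
      (by exact (Real.measurable_log.comp hg.ennreal_toReal).aestronglyMeasurable) hd.aemeasurable]
    refine ⟨((Real.measurable_log.comp hg.ennreal_toReal).comp hd).aestronglyMeasurable, ?_⟩
    rw [hasFiniteIntegral_iff_enorm, ← Measure.restrict_eq_self_of_ae_mem hSae,
      lintegral_countable _ hS]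
    have e : ∀ y : S, ‖((fun p => Real.log (g p).toReal) ∘ fun y => (y, y)) (y:ℝ)‖ₑ * q {(y:ℝ)} =
        ‖(q {(y:ℝ)}).toReal * Real.log (q {(y : ℝ)}).toReal‖ₑ := by
      intro y
      have : ‖(q {(y:ℝ)}).toReal‖ₑ = q {(y:ℝ)} := by
        rw [Real.enorm_of_nonneg ENNReal.toReal_nonneg, ENNReal.ofReal_toReal (measure_ne_top _ _)]
      rw [enorm_mul, this, mul_comm]
      simp [g, ENNReal.toReal_inv]
    have e2 : ∀ y : S, (q.restrict S) {(y:ℝ)} = q {(y:ℝ)} := fun y => by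
      rw [Measure.restrict_eq_self_of_ae_mem hSae]
    simp_rw [e]
    have := hsummable.norm
    rw [← tsum_enorm_ne_top_iff_summable_norm] at this
    exact this.lt_top

lemma hc_eq_one_of {Ω : Type*} [MeasurableSpace Ω] (P : Measure Ω) (X Y : Ω → ℝ)
    (w : MarkovWitness (P.map (fun ω => (X ω, Y ω))))
    (h0 : 0 < mutInfoE w.U w.X w.P) (h1 : mutInfoE w.U w.X w.P < ⊤)
    (he : mutInfoE w.U w.Y w.P = mutInfoE w.U w.X w.P) : hc P X Y = 1 := by
  refine IsGreatest.csSup_eq ⟨⟨w, h0, h1, ?_⟩, ?_⟩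
  · rw [he, div_self]
    exact (EReal.toReal_pos h0 h1.ne).ne'
  · rintro t ⟨v, v0, v1, rfl⟩
    have hp := EReal.toReal_pos v0 v1.ne
    rw [div_le_one hp]
    by_cases hb : mutInfoE v.U v.Y v.P = ⊥
    · rw [hb]; simpa using hp.le
    exact EReal.toReal_le_toReal (mutInfoE_dpi v.P v.U v.X v.Y v.measU v.measX v.measY v.markov)
      hb v1.ne

/-- **Axiom 6' for the hypercontractivity coefficient in the discrete deterministic case.**
If `f(X)` is a discrete random variable (its law is carried by a countable set `S`) with finite,
strictly positive Shannon entropy, then `s(X; f(X)) = 1` and `s(f(X); X) = 1`. -/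
theorem hc_deterministic_function {Ω : Type*} [MeasurableSpace Ω] (P : Measure Ω)
    [IsProbabilityMeasure P] (X : Ω → ℝ) (hX : Measurable X)
    (f : ℝ → ℝ) (hf : Measurable f)
    (S : Set ℝ) (hS : S.Countable) (hfull : P {ω | f (X ω) ∈ S} = 1)
    (hsummable : Summable (fun y : S =>
      (P {ω | f (X ω) = (y : ℝ)}).toReal * Real.log (P {ω | f (X ω) = (y : ℝ)}).toReal))
    (hpos : 0 < -∑' y : S,
      (P {ω | f (X ω) = (y : ℝ)}).toReal * Real.log (P {ω | f (X ω) = (y : ℝ)}).toReal) :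
    hc P X (fun ω => f (X ω)) = 1 ∧ hc P (fun ω => f (X ω)) X = 1 := by
  have hfX : Measurable (fun ω => f (X ω)) := hf.comp hX
  set ν : Measure ℝ := P.map X with hν
  have i1 : IsProbabilityMeasure ν := Measure.isProbabilityMeasure_map hX.aemeasurable
  have i2 : IsProbabilityMeasure (ν.map f) := Measure.isProbabilityMeasure_map hf.aemeasurable
  have hq : ∀ y : ℝ, (ν.map f) {y} = P {ω | f (X ω) = y} := by
    intro y
    rw [hν, Measure.map_map hf hX, Measure.map_apply (hf.comp hX) (measurableSet_singleton y)]
    rfl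
  have hqS : (ν.map f) S = 1 := by
    rw [hν, Measure.map_map hf hX, Measure.map_apply (hf.comp hX) hS.measurableSet]
    exact hfull
  have hk := kl_diag (ν.map f) S hS hqS (by simpa only [hq] using hsummable)
    (by simpa only [hq] using hpos)
  have hff : mutInfoE f f ν = ((InformationTheory.klDiv ((ν.map f).map (fun y => (y, y)))
      ((ν.map f).prod (ν.map f)) : ENNReal) : EReal) := by
    have i3 := Measure.isProbabilityMeasure_map (μ := ν.map f) (f := fun y : ℝ => (y, y))
      (by fun_prop)
    rw [← klDivE_eq_klDiv, Measure.map_map (by fun_prop) hf]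
    rfl
  have hff0 : 0 < mutInfoE f f ν := by
    rw [hff]
    exact_mod_cast pos_iff_ne_zero.2 hk.1
  have hff1 : mutInfoE f f ν < ⊤ := by
    rw [hff, lt_top_iff_ne_top]
    simpa using hk.2
  have m1 : CondIndepFun (MeasurableSpace.comap (fun x : ℝ => x) inferInstance)
      measurable_id.comap_le f f ν :=
    condIndepFun_of_measurable_left (hf.comp (comap_measurable _)) hf
  have m2 : CondIndepFun (MeasurableSpace.comap f inferInstance)
      hf.comap_le f (fun x : ℝ => x) ν :=
    condIndepFun_of_measurable_left (comap_measurable f) measurable_id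
  have hfx : mutInfoE f f ν = mutInfoE f (fun x : ℝ => x) ν :=
    le_antisymm (mutInfoE_dpi ν f (fun x => x) f hf measurable_id hf m1)
      (mutInfoE_dpi ν f f (fun x => x) hf hf measurable_id m2)
  constructor
  · refine hc_eq_one_of P X _
      { Ω := ℝ, P := ν, A := ℝ, U := f, X := fun x => x, Y := f, measU := hf,
        measX := measurable_id, measY := hf, law_eq := ?_, markov := m1 } ?_ ?_ ?_
    · rw [hν, Measure.map_map (by fun_prop) hX]; rfl
    · exact hfx ▸ hff0
    · exact hfx ▸ hff1
    · exact hfx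
  · refine hc_eq_one_of P _ X
      { Ω := ℝ, P := ν, A := ℝ, U := f, X := f, Y := fun x => x, measU := hf,
        measX := hf, measY := measurable_id, law_eq := ?_, markov := m2 } ?_ ?_ ?_
    · rw [hν, Measure.map_map (by fun_prop) hX]; rfl
    · exact hff0
    · exact hff1
    · exact hfx.symm
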